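/- Fix 0 < q < 1, a real number a > 0, integers N ≥ 2 and 1 ≤ n ≤ N-1, and a parameter -1 < α < 2a. The dual q-Hahn polynomial W_n^{(α)}(·;q) has n distinct real zeros X_1(α) < ⋯ < X_n(α). If a ≥ 1/2, then for each j ∈ {1,...,n} the zero X_j(α) is a strictly increasing function of α on (-1, 2a). If 0 < a < 1/2, then each zero X_j(α) is a strictly increasing function of α on (a - 1/2, 2a). -/

import Mathlib

/-- q-Pochhammer symbol `(a;q)_k = ∏_{j=0}^{k-1} (1 - a q^j)`. -/
noncomputable def qpoch (q a : ℝ) (k : ℕ) : ℝ := ∏ j ∈ Finset.range k, (1 - a * q ^ j)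

/-- Dual q-Hahn polynomial `W_n^{(α)}(X;q)` in the variable `X` of the q-quadratic grid
`X = (q^s + q^{-s})/2`. -/
noncomputable def dualQHahnPoly (q a : ℝ) (N n : ℕ) (α X : ℝ) : ℝ :=
  ∑ k ∈ Finset.range (n + 1),
    qpoch q (q ^ (-(n : ℤ))) k *
      (∏ j ∈ Finset.range k,
        (1 - 2 * q ^ (a + (j : ℝ)) * X + q ^ (2 * (a + (j : ℝ))))) /
      (qpoch q (q ^ (α + 1)) k * qpoch q (q ^ ((1 : ℝ) - (N : ℝ))) k * qpoch q q k) *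
      q ^ k

open Polynomial Finset

/-- A finite product of distinct linear factors of `p` captures all sign changes of `p`. -/
theorem exists_finset_prod_dvd_mul_sign (n : ℕ) : ∀ p : ℝ[X], p ≠ 0 → p.natDegree ≤ n →
    ∃ S : Finset ℝ, (∏ s ∈ S, (X - C s)) ∣ p ∧
      ((∀ y, 0 ≤ (p * ∏ s ∈ S, (X - C s)).eval y) ∨
        (∀ y, (p * ∏ s ∈ S, (X - C s)).eval y ≤ 0)) := by
  induction n with
  | zero =>
    intro p _ hd
    refine ⟨∅, by simp, ?_⟩
    obtain ⟨c, rfl⟩ := natDegree_eq_zero.1 (Nat.le_zero.1 hd)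
    simpa using le_total 0 c
  | succ n ih =>
    intro p hp hd
    by_cases hroot : ∃ r, p.IsRoot r
    · obtain ⟨r, hr⟩ := hroot
      obtain ⟨p₁, rfl⟩ := dvd_iff_isRoot.2 hr
      have hp₁ : p₁ ≠ 0 := right_ne_zero_of_mul hp
      have hd₁ : p₁.natDegree ≤ n := by
        rw [natDegree_mul (X_sub_C_ne_zero r) hp₁, natDegree_X_sub_C] at hd
        omega
      obtain ⟨S, hS, hsign⟩ := ih p₁ hp₁ hd₁
      by_cases hrS : r ∈ S
      · have hprod := Finset.mul_prod_erase S (fun s => X - C s) hrS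
        refine ⟨S.erase r, ?_, ?_⟩
        · exact (Dvd.intro_left _ hprod).trans (hS.trans (Dvd.intro_left _ rfl))
        · have : (X - C r) * p₁ * ∏ s ∈ S.erase r, (X - C s) = p₁ * ∏ s ∈ S, (X - C s) := by
            rw [← hprod]; ring
          rwa [this]
      · refine ⟨insert r S, ?_, ?_⟩
        · rw [prod_insert hrS]
          exact mul_dvd_mul_left _ hS
        · have : (X - C r) * p₁ * ∏ s ∈ insert r S, (X - C s)
              = (X - C r) ^ 2 * (p₁ * ∏ s ∈ S, (X - C s)) := by
            rw [prod_insert hrS]; ring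
          rw [this]
          refine hsign.imp (fun h y => ?_) (fun h y => ?_) <;>
            rw [eval_mul, eval_pow]
          · exact mul_nonneg (sq_nonneg _) (h y)
          · exact mul_nonpos_of_nonneg_of_nonpos (sq_nonneg _) (h y)
    · refine ⟨∅, by simp, ?_⟩
      simp only [prod_empty, mul_one]
      by_contra! h
      obtain ⟨⟨y, hy⟩, ⟨z, hz⟩⟩ := h
      obtain ⟨t, ht⟩ := mem_range_of_exists_le_of_exists_ge p.continuous ⟨y, hy.le⟩ ⟨z, hz.le⟩
      exact hroot ⟨t, ht⟩

/-- A nonzero polynomial whose degree is below the number of nodes is nonzero at some node. -/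
theorem exists_eval_ne_zero_of_natDegree_lt {x : ℕ → ℝ} (hx : StrictMono x) {I : Finset ℕ}
    {p : ℝ[X]} (hp : p ≠ 0) (hd : p.natDegree < I.card) : ∃ i ∈ I, p.eval (x i) ≠ 0 := by
  by_contra! h
  refine hp (eq_zero_of_natDegree_lt_card_of_eval_eq_zero' p (I.image x) ?_ ?_)
  · simpa using h
  · rwa [card_image_of_injective _ hx.injective]

/-- A polynomial orthogonal, for a positive discrete weight, to all polynomials of lower degree
has only real simple zeros. -/
theorem exists_eq_C_mul_prod_of_orthogonal {N n : ℕ} {x w : ℕ → ℝ} (hx : StrictMono x)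
    (hw : ∀ i < N, 0 < w i) {p : ℝ[X]} (hp : p ≠ 0) (hd : p.natDegree = n) (hn : n < N)
    (horth : ∀ g : ℝ[X], g.degree < n → ∑ i ∈ range N, w i * (p * g).eval (x i) = 0) :
    ∃ S : Finset ℝ, S.card = n ∧ p = C p.leadingCoeff * ∏ s ∈ S, (X - C s) := by
  obtain ⟨S, ⟨r, hr⟩, hsign⟩ := exists_finset_prod_dvd_mul_sign n p hp hd.le
  have hdeg : (∏ s ∈ S, (X - C s)).natDegree = S.card := by simp
  have hmonic : (∏ s ∈ S, (X - C s)).Monic := monic_prod_of_monic _ _ fun s _ => monic_X_sub_C s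
  have hr0 : r ≠ 0 := by
    rintro rfl
    exact hp (by simpa using hr)
  have hnd : n = S.card + r.natDegree := by
    rw [← hd, ← hdeg, ← natDegree_mul hmonic.ne_zero hr0, ← hr]
  have hcard : S.card = n := by
    by_contra hne
    have hlt : S.card < n := by omega
    have hsum := horth (∏ s ∈ S, (X - C s)) (by
      rw [degree_eq_natDegree hmonic.ne_zero, hdeg]
      exact_mod_cast hlt)
    obtain ⟨i, hi, hpi⟩ := exists_eval_ne_zero_of_natDegree_lt hx hp
      (I := range N) (by rw [card_range, hd]; exact hn)
    have hzero : ∀ i ∈ range N, w i * (p * ∏ s ∈ S, (X - C s)).eval (x i) = 0 := by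
      rcases hsign with h | h
      · exact (sum_eq_zero_iff_of_nonneg fun i hi =>
          mul_nonneg (hw i (mem_range.1 hi)).le (h _)).1 hsum
      · exact (sum_eq_zero_iff_of_nonpos fun i hi =>
          mul_nonpos_of_nonneg_of_nonpos (hw i (mem_range.1 hi)).le (h _)).1 hsum
    have hprod := (mul_eq_zero.1 (hzero i hi)).resolve_left (hw i (mem_range.1 hi)).ne'
    rw [eval_mul] at hprod
    refine hpi ?_
    rw [hr, eval_mul, (mul_eq_zero.1 hprod).resolve_left hpi, zero_mul]
  refine ⟨S, hcard, ?_⟩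
  obtain ⟨c, rfl⟩ := natDegree_eq_zero.1 (show r.natDegree = 0 by omega)
  have hlead : p.leadingCoeff = c := by
    rw [hr, leadingCoeff_mul, hmonic.leadingCoeff, one_mul, leadingCoeff_C]
  rw [hlead, mul_comm]
  exact hr

/-- Positivity of Gaussian quadrature at the zeros of a polynomial that is orthogonal for a
nonnegative discrete weight. -/
theorem sum_nonneg_of_eval_nonneg_of_orthogonal {N : ℕ} {x w : ℕ → ℝ}
    (hw : ∀ i < N, 0 ≤ w i) {S : Finset ℝ}
    (horth : ∀ g : ℝ[X], g.degree < S.card →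
      ∑ i ∈ range N, w i * ((∏ s ∈ S, (X - C s)) * g).eval (x i) = 0)
    {F : ℝ[X]} (hF : F.degree < (2 * S.card : ℕ)) (hpos : ∀ s ∈ S, 0 ≤ F.eval s) :
    0 ≤ ∑ i ∈ range N, w i * F.eval (x i) := by
  set B : ℝ → ℝ[X] := fun s => Lagrange.basis S id s with hB
  set G : ℝ[X] := ∑ s ∈ S, C (F.eval s) * B s ^ 2 with hG
  have hmonic : (∏ s ∈ S, (X - C s)).Monic := monic_prod_of_monic _ _ fun s _ => monic_X_sub_C s
  have hdeg : (∏ s ∈ S, (X - C s)).degree = (S.card : WithBot ℕ) := by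
    rw [degree_eq_natDegree hmonic.ne_zero]; simp
  have hGdeg : G.degree < (2 * S.card : ℕ) := by
    rcases S.eq_empty_or_nonempty with rfl | hne
    · simp [hG]
    refine (degree_sum_le _ _).trans_lt ((Finset.sup_lt_iff (WithBot.bot_lt_coe _)).2 fun s hs => ?_)
    refine (degree_le_natDegree).trans_lt ?_
    have h1 : (B s).natDegree = S.card - 1 :=
      natDegree_eq_of_degree_eq_some (Lagrange.degree_basis (Set.injOn_id _) hs)
    have h2 := (natDegree_C_mul_le (F.eval s) (B s ^ 2)).trans natDegree_pow_le
    have := hne.card_pos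
    rw [h1] at h2
    exact_mod_cast (show (C (F.eval s) * B s ^ 2).natDegree < 2 * S.card by omega)
  have hvanish : ∀ s ∈ S, (F - G).IsRoot s := by
    intro s hs
    have : G.eval s = F.eval s := by
      rw [hG, eval_finsetSum, Finset.sum_eq_single_of_mem s hs]
      · have := Lagrange.eval_basis_self (s := S) (v := id) (Set.injOn_id _) hs
        simp only [id] at this
        simp [hB, this]
      · intro t ht hts
        have := Lagrange.eval_basis_of_ne (s := S) (v := id) hts hs
        simp only [id] at this
        simp [hB, this]
    simp [this]
  have hdvd : (∏ s ∈ S, (X - C s)) ∣ F - G :=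
    Finset.prod_dvd_of_coprime
      (fun s _ t _ hst => isCoprime_X_sub_C_of_isUnit_sub (sub_ne_zero.2 hst).isUnit)
      fun s hs => dvd_iff_isRoot.2 (hvanish s hs)
  obtain ⟨g, hg⟩ := hdvd
  have hgdeg : g.degree < S.card := by
    by_contra! hge
    have h1 : (F - G).degree < (2 * S.card : ℕ) :=
      (degree_sub_le _ _).trans_lt (max_lt hF hGdeg)
    rw [hg, degree_mul, hdeg] at h1
    have h2 : ((2 * S.card : ℕ) : WithBot ℕ) ≤ S.card + g.degree := by
      rw [two_mul, Nat.cast_add]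
      gcongr
    exact absurd h1 (not_lt.2 h2)
  have h0 := horth g hgdeg
  rw [← hg] at h0
  have : ∑ i ∈ range N, w i * F.eval (x i) = ∑ i ∈ range N, w i * G.eval (x i) := by
    rw [← sub_eq_zero, ← h0, ← Finset.sum_sub_distrib]
    exact Finset.sum_congr rfl fun i _ => by rw [eval_sub]; ring
  rw [this]
  refine Finset.sum_nonneg fun i hi => mul_nonneg (hw i (mem_range.1 hi)) ?_
  rw [hG, eval_finsetSum]
  refine Finset.sum_nonneg fun s hs => ?_
  rw [eval_mul, eval_C, eval_pow]
  exact mul_nonneg (hpos s hs) (sq_nonneg _)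

/-- A real number splits the increasing nodes `x 0, …, x m` at some index. -/
theorem exists_splitting_index {x : ℕ → ℝ} (hx : StrictMono x) (m : ℕ) (c : ℝ) :
    ∃ k ≤ m, (∀ i < k, x i < c) ∧ ∀ i ≤ m, k < i → c < x i := by
  by_cases h : ∃ k, k ≤ m ∧ c ≤ x k
  · classical
    refine ⟨Nat.find h, (Nat.find_spec h).1, fun i hi => ?_, fun i _ hi => ?_⟩
    · have := Nat.find_min h hi
      by_contra! hc
      exact this ⟨hi.le.trans (Nat.find_spec h).1, hc⟩
    · exact (Nat.find_spec h).2.trans_lt (hx hi)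
  · push Not at h
    exact ⟨m, le_rfl, fun i hi => h i hi.le, fun i him hi => by omega⟩

/-- Markov's comparison of zeros: if the ratio of two discrete weights increases strictly, so do
the zeros of the orthogonal polynomials. -/
theorem orderEmbOfFin_lt_of_strictMono_ratio {N n : ℕ} (hn : n < N) {x w W ρ : ℕ → ℝ}
    (hx : StrictMono x) (hw : ∀ i < N, 0 < w i) (hW : ∀ i < N, W i = ρ i * w i)
    (hρ0 : ∀ i < N, 0 < ρ i) (hρ : ∀ i j, i < j → j < N → ρ i < ρ j) {S T : Finset ℝ}
    (hS : S.card = n) (hT : T.card = n)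
    (horthS : ∀ g : ℝ[X], g.degree < n →
      ∑ i ∈ range N, w i * ((∏ s ∈ S, (X - C s)) * g).eval (x i) = 0)
    (horthT : ∀ g : ℝ[X], g.degree < n →
      ∑ i ∈ range N, W i * ((∏ s ∈ T, (X - C s)) * g).eval (x i) = 0) (j : Fin n) :
    S.orderEmbOfFin hS j < T.orderEmbOfFin hT j := by
  by_contra! hle
  set s := S.orderEmbOfFin hS with hs
  set t := T.orderEmbOfFin hT with ht
  set c := s j with hc
  have hsmem : ∀ r ∈ S, ∃ i, s i = r := fun r hr => by
    have : r ∈ Set.range s := by rw [hs, range_orderEmbOfFin]; exact hr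
    exact this
  have htmem : ∀ r ∈ T, ∃ i, t i = r := fun r hr => by
    have : r ∈ Set.range t := by rw [ht, range_orderEmbOfFin]; exact hr
    exact this
  set f : ℝ[X] := ∏ i ∈ univ.erase j, (X - C (if i < j then s i else t i)) with hf
  have hfmonic : f.Monic := monic_prod_of_monic _ _ fun i _ => monic_X_sub_C _
  have hfdeg : f.natDegree = n - 1 := by
    rw [hf, natDegree_prod_of_monic _ _ fun i _ => monic_X_sub_C _]
    simp
  have hjn : j.val < n := j.isLt
  have hfeval : ∀ i, i ≠ j → f.eval (if i < j then s i else t i) = 0 := by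
    intro i hij
    rw [hf, eval_prod]
    exact prod_eq_zero (mem_erase.2 ⟨hij, mem_univ i⟩) (by simp)
  set F : ℝ[X] := (X - C c) * f ^ 2 with hF
  have hFdeg : F.degree < (2 * n : ℕ) := by
    refine degree_le_natDegree.trans_lt ?_
    have : F.natDegree ≤ 1 + 2 * (n - 1) := by
      refine natDegree_mul_le.trans (add_le_add (natDegree_X_sub_C c).le ?_)
      refine natDegree_pow_le.trans ?_
      rw [hfdeg]
    exact_mod_cast (show F.natDegree < 2 * n by omega)
  have hFeval : ∀ y, F.eval y = (y - c) * f.eval y ^ 2 := fun y => by simp [hF]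
  have hnonneg : 0 ≤ ∑ i ∈ range N, w i * F.eval (x i) := by
    refine sum_nonneg_of_eval_nonneg_of_orthogonal (S := S) (fun i hi => (hw i hi).le)
      (by rwa [hS]) (by rwa [hS]) fun r hr => ?_
    obtain ⟨i, rfl⟩ := hsmem r hr
    rw [hFeval]
    rcases lt_or_ge i j with hij | hij
    · have := hfeval i hij.ne
      rw [if_pos hij] at this
      simp [this]
    · exact mul_nonneg (sub_nonneg.2 (s.monotone hij)) (sq_nonneg _)
  have hnonpos : 0 ≤ ∑ i ∈ range N, W i * (-F).eval (x i) := by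
    refine sum_nonneg_of_eval_nonneg_of_orthogonal (S := T)
      (fun i hi => by rw [hW i hi]; exact (mul_pos (hρ0 i hi) (hw i hi)).le)
      (by rwa [hT]) (by rwa [hT, degree_neg]) fun r hr => ?_
    obtain ⟨i, rfl⟩ := htmem r hr
    rw [eval_neg, hFeval]
    rcases lt_or_ge j i with hij | hij
    · have := hfeval i hij.ne'
      rw [if_neg hij.not_gt] at this
      simp [this]
    · rw [neg_nonneg]
      exact mul_nonpos_of_nonpos_of_nonneg
        (sub_nonpos.2 ((t.monotone hij).trans hle)) (sq_nonneg _)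
  obtain ⟨k, hk, hlow, hhigh⟩ := exists_splitting_index hx (N - 1) c
  have hkN : k < N := by omega
  obtain ⟨l, hl, hfl⟩ := exists_eval_ne_zero_of_natDegree_lt hx hfmonic.ne_zero
    (I := (range N).erase k) (by
      rw [card_erase_of_mem (mem_range.2 hkN), card_range, hfdeg]; omega)
  have hterm : ∀ i < N, i ≠ k → 0 < (ρ i - ρ k) * (x i - c) := by
    intro i hi hik
    rcases lt_or_gt_of_ne hik with h | h
    · exact mul_pos_of_neg_of_neg (sub_neg.2 (hρ i k h hkN)) (sub_neg.2 (hlow i h))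
    · exact mul_pos (sub_pos.2 (hρ k i h hi)) (sub_pos.2 (hhigh i (by omega) h))
  have hpos : 0 < ∑ i ∈ range N, w i * ((ρ i - ρ k) * (x i - c)) * f.eval (x i) ^ 2 := by
    refine sum_pos' (fun i hi => ?_) ⟨l, mem_of_mem_erase hl, ?_⟩
    · have hi := mem_range.1 hi
      rcases eq_or_ne i k with rfl | hik
      · simp
      · exact mul_nonneg (mul_nonneg (hw i hi).le (hterm i hi hik).le) (sq_nonneg _)
    · have hlN := mem_range.1 (mem_of_mem_erase hl)
      exact mul_pos (mul_pos (hw l hlN) (hterm l hlN (ne_of_mem_erase hl)))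
        (by positivity)
  have hsplit : ∑ i ∈ range N, w i * ((ρ i - ρ k) * (x i - c)) * f.eval (x i) ^ 2
      = -(∑ i ∈ range N, W i * (-F).eval (x i))
        - ρ k * ∑ i ∈ range N, w i * F.eval (x i) := by
    rw [mul_sum, ← sum_neg_distrib, ← sum_sub_distrib]
    refine sum_congr rfl fun i hi => ?_
    rw [hW i (mem_range.1 hi), eval_neg, hFeval]
    ring
  have := mul_nonneg (hρ0 k hkN).le hnonneg
  linarith

/-- The nodes of the `q`-quadratic grid, with `b = q ^ a`. -/
noncomputable def qQuadraticGrid (q b : ℝ) (i : ℕ) : ℝ := (b * q ^ i + (b * q ^ i)⁻¹) / 2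

/-- The Newton-type basis on the `q`-quadratic grid. -/
noncomputable def qQuadraticBasis (q b : ℝ) (k : ℕ) : ℝ[X] :=
  ∏ j ∈ range k, (C (1 + (b * q ^ j) ^ 2) - C (2 * (b * q ^ j)) * X)

/-- The ratio of consecutive dual `q`-Hahn weights, with `A = q ^ (2 * a)`, `g = q ^ α` and
`K = q ^ (N - 1)`. -/
noncomputable def dualQHahnWeightRatio (q A g K : ℝ) (i : ℕ) : ℝ :=
  (q ^ i - K) * (1 - A * q ^ i) * (1 - A * q ^ 2 * (q ^ i) ^ 2) /
    (q * q ^ i * (1 - A * (q ^ i) ^ 2) * (1 - q * q ^ i) * (1 - A * K * q * q ^ i)) *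
    ((1 - g * q * q ^ i) / (g - A * q ^ i))

/-- The orthogonality weight of the dual `q`-Hahn polynomials. -/
noncomputable def dualQHahnWeight (q A g K : ℝ) (i : ℕ) : ℝ :=
  ∏ j ∈ range i, dualQHahnWeightRatio q A g K j

/-- The conductance between consecutive nodes for the dual `q`-Hahn difference operator. -/
noncomputable def dualQHahnConductance (q A g K : ℝ) (i : ℕ) : ℝ :=
  dualQHahnWeight q A g K i * ((q ^ i - K) * (1 - g * q * q ^ i) * (1 - A * q ^ i) /
    (K * (1 - A * (q ^ i) ^ 2) * (1 - A * q * (q ^ i) ^ 2)))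

theorem qpoch_zero (q a : ℝ) : qpoch q a 0 = 1 := by simp [qpoch]

theorem qpoch_succ (q a : ℝ) (k : ℕ) : qpoch q a (k + 1) = qpoch q a k * (1 - a * q ^ k) :=
  prod_range_succ _ _

theorem qpoch_succ' (q a : ℝ) (k : ℕ) : qpoch q a (k + 1) = (1 - a) * qpoch q (a * q) k := by
  simp only [qpoch, prod_range_succ', pow_zero, mul_one, pow_succ']
  rw [mul_comm]
  congr 1
  exact prod_congr rfl fun j _ => by ring

theorem qQuadraticGrid_strictMono {q b : ℝ} (hq0 : 0 < q) (hq1 : q < 1) (hb0 : 0 < b)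
    (hb1 : b < 1) : StrictMono (qQuadraticGrid q b) := by
  refine strictMono_nat_of_lt_succ fun i => ?_
  have ht : 0 < b * q ^ i := by positivity
  have ht1 : b * q ^ i < 1 := mul_lt_one_of_nonneg_of_lt_one_left hb0.le hb1 (pow_le_one₀ hq0.le hq1.le)
  unfold qQuadraticGrid
  rw [pow_succ, ← mul_assoc]
  generalize b * q ^ i = t at ht ht1
  have h : (t * q + (t * q)⁻¹) / 2 - (t + t⁻¹) / 2 = (1 - q) * (1 - t ^ 2 * q) / (2 * t * q) := by
    field_simp
    ring
  have : t ^ 2 * q < 1 := by nlinarith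
  have : 0 < (1 - q) * (1 - t ^ 2 * q) / (2 * t * q) :=
    div_pos (mul_pos (by linarith) (by linarith)) (by positivity)
  linarith

theorem eval_qQuadraticBasis (q b : ℝ) (k : ℕ) (y : ℝ) : (qQuadraticBasis q b k).eval y =
    ∏ j ∈ range k, (1 - 2 * (b * q ^ j) * y + (b * q ^ j) ^ 2) := by
  rw [qQuadraticBasis, eval_prod]
  refine prod_congr rfl fun j _ => ?_
  simp only [eval_sub, eval_C, eval_mul, eval_X]
  ring

theorem eval_qQuadraticBasis_grid {q b : ℝ} (hq : q ≠ 0) (hb : b ≠ 0) (k i : ℕ) :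
    (qQuadraticBasis q b k).eval (qQuadraticGrid q b i) =
      qpoch q (q ^ i)⁻¹ k * qpoch q (b ^ 2 * q ^ i) k := by
  rw [eval_qQuadraticBasis, qpoch, qpoch, ← prod_mul_distrib]
  refine prod_congr rfl fun j _ => ?_
  unfold qQuadraticGrid
  field_simp
  ring

theorem degree_qQuadraticBasis {q b : ℝ} (hq : q ≠ 0) (hb : b ≠ 0) (k : ℕ) :
    (qQuadraticBasis q b k).degree = k := by
  have h : ∀ j, (C (1 + (b * q ^ j) ^ 2) - C (2 * (b * q ^ j)) * X).degree = 1 := by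
    intro j
    have : C (1 + (b * q ^ j) ^ 2) - C (2 * (b * q ^ j)) * X
        = C (-(2 * (b * q ^ j))) * X + C (1 + (b * q ^ j) ^ 2) := by
      rw [C_neg]; ring
    rw [this]
    exact degree_linear (by simp [hq, hb])
  rw [qQuadraticBasis, degree_prod, sum_congr rfl fun j _ => h j]
  simp

/-- The forward difference of the basis along the grid. -/
theorem qpoch_mul_qpoch_forward_difference {q u : ℝ} (hq : q ≠ 0) (hu : u ≠ 0) (A : ℝ) (k : ℕ) :
    (1 - A * u) * (qpoch q (q * u)⁻¹ (k + 1) * qpoch q (A * (q * u)) (k + 1)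
      - qpoch q u⁻¹ (k + 1) * qpoch q (A * u) (k + 1)) =
    (q ^ (k + 1) - 1) * (1 - A * q * u ^ 2) / (q * u) * (1 - A * u * q ^ k)
      * (qpoch q u⁻¹ k * qpoch q (A * u) k) := by
  have h1 : qpoch q (A * u) k * (1 - A * u * q ^ k) = (1 - A * u) * qpoch q (A * (q * u)) k := by
    rw [← qpoch_succ, qpoch_succ']; ring_nf
  have h2 : qpoch q (q * u)⁻¹ (k + 1) = (1 - (q * u)⁻¹) * qpoch q u⁻¹ k := by
    rw [qpoch_succ']; congr 2; field_simp
  rw [h2, qpoch_succ q (A * (q * u)), qpoch_succ q u⁻¹, qpoch_succ q (A * u), h1]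
  have : (q ^ (k + 1) - 1) * (1 - A * q * u ^ 2) / (q * u) * (1 - A * u * q ^ k)
      * (qpoch q u⁻¹ k * qpoch q (A * u) k) =
      (q ^ (k + 1) - 1) * (1 - A * q * u ^ 2) / (q * u)
      * (qpoch q u⁻¹ k * (qpoch q (A * u) k * (1 - A * u * q ^ k))) := by ring
  rw [this, h1]
  field_simp
  ring

/-- The backward difference of the basis along the grid. -/
theorem qpoch_mul_qpoch_backward_difference {q v : ℝ} (hq : q ≠ 0) (hv : v ≠ 0) (A : ℝ) (k : ℕ) :
    (1 - (q * v)⁻¹) * (qpoch q (q * v)⁻¹ (k + 1) * qpoch q (A * (q * v)) (k + 1)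
      - qpoch q v⁻¹ (k + 1) * qpoch q (A * v) (k + 1)) =
    (q ^ (k + 1) - 1) * (1 - A * q * v ^ 2) / (q * v) * (1 - (q * v)⁻¹ * q ^ k)
      * (qpoch q (q * v)⁻¹ k * qpoch q (A * (q * v)) k) := by
  have h1 : qpoch q (q * v)⁻¹ k * (1 - (q * v)⁻¹ * q ^ k) = (1 - (q * v)⁻¹) * qpoch q v⁻¹ k := by
    rw [← qpoch_succ, qpoch_succ']; congr 2; field_simp
  have h2 : qpoch q (A * v) (k + 1) = (1 - A * v) * qpoch q (A * (q * v)) k := by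
    rw [qpoch_succ']; ring_nf
  rw [h2, qpoch_succ q (A * (q * v)), qpoch_succ q v⁻¹, qpoch_succ q (q * v)⁻¹, h1]
  have : (q ^ (k + 1) - 1) * (1 - A * q * v ^ 2) / (q * v) * (1 - (q * v)⁻¹ * q ^ k)
      * (qpoch q (q * v)⁻¹ k * qpoch q (A * (q * v)) k) =
      (q ^ (k + 1) - 1) * (1 - A * q * v ^ 2) / (q * v)
      * ((qpoch q (q * v)⁻¹ k * (1 - (q * v)⁻¹ * q ^ k)) * qpoch q (A * (q * v)) k) := by ring
  rw [this, h1]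
  field_simp
  ring

theorem dualQHahn_rational_identity {q g K u z : ℝ} (hq : q ≠ 0) (hK : K ≠ 0)
    (hu : u ≠ 0) (hz : z ≠ 0) (A : ℝ) :
    -((1 - u / K) * (1 - g * q * u) * (1 - A * u * z) / (q * u))
      + u / K * (1 - A * K * u) * (g - A * u / q) * (1 - z / u) =
    (1 - A * u ^ 2) * ((1 - z / u) * (1 - A * u * z) / (q * z)
      - (1 - z / K) * (1 - g * q * z) / (q * z)) := by
  field_simp
  ring

/-- Admissible parameters: `q ∈ (0, 1)`, `A = q ^ (2 * a)`, `g = q ^ α`. -/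
structure DualQHahnParams (q A g : ℝ) : Prop where
  q_pos : 0 < q
  q_lt_one : q < 1
  A_pos : 0 < A
  A_lt_one : A < 1
  A_lt_g : A < g
  g_mul_q_lt_one : g * q < 1

namespace DualQHahnParams

variable {q A g : ℝ}

theorem g_pos (h : DualQHahnParams q A g) : 0 < g := h.A_pos.trans h.A_lt_g

theorem one_sub_pos (h : DualQHahnParams q A g) {y : ℝ} (hy : y ≤ 1) :
    0 < 1 - A * y := by
  nlinarith [h.A_lt_one, h.A_pos]

theorem pow_pos (h : DualQHahnParams q A g) (i : ℕ) : 0 < q ^ i := _root_.pow_pos h.q_pos i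

theorem pow_le_one (h : DualQHahnParams q A g) (i : ℕ) : q ^ i ≤ 1 :=
  pow_le_one₀ h.q_pos.le h.q_lt_one.le

theorem one_sub_A_mul_pos (h : DualQHahnParams q A g) (i : ℕ) : 0 < 1 - A * q ^ i :=
  h.one_sub_pos (h.pow_le_one i)

theorem one_sub_g_mul_pos (h : DualQHahnParams q A g) (i : ℕ) : 0 < 1 - g * q * q ^ i := by
  have h1 := mul_le_of_le_one_right (mul_pos h.g_pos h.q_pos).le (h.pow_le_one i)
  linarith [h.g_mul_q_lt_one]

theorem g_sub_pos (h : DualQHahnParams q A g) (i : ℕ) : 0 < g - A * q ^ i := by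
  have h1 := mul_le_of_le_one_right h.A_pos.le (h.pow_le_one i)
  linarith [h.A_lt_g]

theorem one_sub_q_mul_pos (h : DualQHahnParams q A g) (i : ℕ) : 0 < 1 - q * q ^ i := by
  have h1 := mul_le_of_le_one_right h.q_pos.le (h.pow_le_one i)
  linarith [h.q_lt_one]

theorem one_sub_A_mul_sq_pos (h : DualQHahnParams q A g) (i : ℕ) :
    0 < 1 - A * (q ^ i) ^ 2 :=
  h.one_sub_pos (pow_le_one₀ (h.pow_pos i).le (h.pow_le_one i))

theorem one_sub_A_mul_q_mul_sq_pos (h : DualQHahnParams q A g) (i : ℕ) :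
    0 < 1 - A * q * (q ^ i) ^ 2 := by
  have := h.one_sub_pos (y := q * (q ^ i) ^ 2) 
    (mul_le_one₀ h.q_lt_one.le (by positivity)
      (pow_le_one₀ (h.pow_pos i).le (h.pow_le_one i)))
  rwa [← mul_assoc] at this

theorem one_sub_A_mul_q_sq_mul_sq_pos (h : DualQHahnParams q A g) (i : ℕ) :
    0 < 1 - A * q ^ 2 * (q ^ i) ^ 2 := by
  have := h.one_sub_A_mul_sq_pos (i + 1)
  linarith [show A * (q ^ (i + 1)) ^ 2 = A * q ^ 2 * (q ^ i) ^ 2 by ring]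

theorem one_sub_A_mul_K_mul_pos (h : DualQHahnParams q A g) (M i : ℕ) :
    0 < 1 - A * q ^ M * q * q ^ i := by
  have := h.one_sub_A_mul_pos (M + 1 + i)
  linarith [show A * q ^ (M + 1 + i) = A * q ^ M * q * q ^ i by ring]

theorem common_ratio_pos (h : DualQHahnParams q A g) {M i : ℕ} (hi : i < M) :
    0 < (q ^ i - q ^ M) * (1 - A * q ^ i) * (1 - A * q ^ 2 * (q ^ i) ^ 2) /
    (q * q ^ i * (1 - A * (q ^ i) ^ 2) * (1 - q * q ^ i) * (1 - A * q ^ M * q * q ^ i)) := by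
  have h0 : 0 < q ^ i - q ^ M := sub_pos.2 (pow_lt_pow_right_of_lt_one₀ h.q_pos h.q_lt_one hi)
  have h1 := h.one_sub_A_mul_pos i
  have h2 := h.one_sub_A_mul_q_sq_mul_sq_pos i
  have h3 := h.one_sub_A_mul_sq_pos i
  have h4 := h.one_sub_q_mul_pos i
  have h5 := h.one_sub_A_mul_K_mul_pos M i
  have h6 := h.pow_pos i
  have h7 := h.q_pos
  positivity

theorem weightRatio_pos (h : DualQHahnParams q A g) {M i : ℕ} (hi : i < M) :
    0 < dualQHahnWeightRatio q A g (q ^ M) i :=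
  mul_pos (h.common_ratio_pos hi) (div_pos (h.one_sub_g_mul_pos i) (h.g_sub_pos i))

theorem weight_pos (h : DualQHahnParams q A g) {M i : ℕ} (hi : i ≤ M) :
    0 < dualQHahnWeight q A g (q ^ M) i :=
  prod_pos fun _ hj => h.weightRatio_pos ((mem_range.1 hj).trans_le hi)

theorem weightRatio_lt {g' : ℝ} (h : DualQHahnParams q A g) (h' : DualQHahnParams q A g')
    (hlt : g' < g) {M i : ℕ} (hi : i < M) :
    dualQHahnWeightRatio q A g (q ^ M) i < dualQHahnWeightRatio q A g' (q ^ M) i := by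
  refine mul_lt_mul_of_pos_left ?_ (h.common_ratio_pos hi)
  have h1 := h'.g_sub_pos i
  have h2 := h'.one_sub_g_mul_pos i
  have hpos := mul_pos h.q_pos (h.pow_pos i)
  gcongr ?_ / ?_
  · nlinarith
  · linarith

/-- Consecutive conductances and weights are tied by detailed balance. -/
theorem conductance_eq (h : DualQHahnParams q A g) (M i : ℕ) :
    dualQHahnConductance q A g (q ^ M) i =
      dualQHahnWeight q A g (q ^ M) (i + 1) * (q * q ^ i / q ^ M * (1 - q * q ^ i)
        * (1 - A * q ^ M * (q * q ^ i)) * (g - A * q ^ i) /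
        ((1 - A * q * (q ^ i) ^ 2) * (1 - A * (q * q ^ i) ^ 2))) := by
  have hs : dualQHahnWeight q A g (q ^ M) (i + 1) =
    dualQHahnWeight q A g (q ^ M) i * dualQHahnWeightRatio q A g (q ^ M) i := prod_range_succ _ _
  rw [hs, dualQHahnConductance, dualQHahnWeightRatio]
  generalize dualQHahnWeight q A g (q ^ M) i = w
  have h1 := (h.g_sub_pos i).ne'
  have h2 := (h.one_sub_A_mul_q_sq_mul_sq_pos i).ne'
  have h3 := (h.one_sub_A_mul_sq_pos i).ne'
  have h4 := (h.one_sub_q_mul_pos i).ne'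
  have h5 := (h.one_sub_A_mul_K_mul_pos M i).ne'
  have h6 := (h.pow_pos i).ne'
  have h7 := h.q_pos.ne'
  have h8 := (h.pow_pos M).ne'
  have h9 := (h.one_sub_A_mul_q_mul_sq_pos i).ne'
  have e1 : 1 - A * q ^ M * (q * q ^ i) = 1 - A * q ^ M * q * q ^ i := by ring
  have e2 : 1 - A * (q * q ^ i) ^ 2 = 1 - A * q ^ 2 * (q ^ i) ^ 2 := by ring
  rw [e1, e2]
  generalize q ^ i = u at *
  generalize q ^ M = K at *
  generalize 1 - A * q ^ 2 * u ^ 2 = a1 at *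
  generalize 1 - A * u ^ 2 = a2 at *
  generalize 1 - q * u = a3 at *
  generalize 1 - A * K * q * u = a4 at *
  generalize 1 - A * q * u ^ 2 = a5 at *
  generalize 1 - A * u = a6 at *
  generalize g - A * u = a7 at *
  field_simp

end DualQHahnParams

/-- The basis functions of the `q`-quadratic grid as functions of the node index. -/
noncomputable def gridBasis (q A : ℝ) (k i : ℕ) : ℝ :=
  qpoch q (q ^ i)⁻¹ k * qpoch q (A * q ^ i) k

/-- The coefficients of the dual `q`-Hahn polynomial of degree `n` in the Newton-type basis. -/
noncomputable def dualQHahnCoeff (q g K : ℝ) (n k : ℕ) : ℝ :=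
  qpoch q (q ^ n)⁻¹ k * q ^ k / (qpoch q (g * q) k * qpoch q K⁻¹ k * qpoch q q k)

/-- The values of the dual `q`-Hahn polynomial at the nodes. -/
noncomputable def dualQHahnValue (q A g K : ℝ) (n i : ℕ) : ℝ :=
  ∑ k ∈ range (n + 1), dualQHahnCoeff q g K n k * gridBasis q A k i

/-- The flux into the node `i` of a function along the grid with conductances `s`. -/
def gridFlux (s f : ℕ → ℝ) : ℕ → ℝ
  | 0 => 0
  | i + 1 => s i * (f (i + 1) - f i)

theorem gridFlux_sum {ι : Type*} (t : Finset ι) (s : ℕ → ℝ) (c : ι → ℝ) (f : ι → ℕ → ℝ) (i : ℕ) :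
    gridFlux s (fun i => ∑ k ∈ t, c k * f k i) i = ∑ k ∈ t, c k * gridFlux s (f k) i := by
  cases i with
  | zero => simp [gridFlux]
  | succ i =>
    simp only [gridFlux]
    rw [← sum_sub_distrib, mul_sum]
    exact sum_congr rfl fun k _ => by ring

theorem sum_gridFlux_sub_mul (s f g : ℕ → ℝ) (m : ℕ) :
    ∑ i ∈ range (m + 1), (gridFlux s f i - gridFlux s f (i + 1)) * g i =
      ∑ i ∈ range m, s i * (f (i + 1) - f i) * (g (i + 1) - g i)
        - s m * (f (m + 1) - f m) * g m := by
  induction m with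
  | zero => simp [gridFlux]
  | succ m ih =>
    rw [sum_range_succ, ih, sum_range_succ _ m]
    simp only [gridFlux]
    ring

/-- Summation by parts: the difference operator is symmetric. -/
theorem sum_gridFlux_sub_mul_comm (s f g : ℕ → ℝ) {m : ℕ} (hs : s m = 0) :
    ∑ i ∈ range (m + 1), (gridFlux s f i - gridFlux s f (i + 1)) * g i =
      ∑ i ∈ range (m + 1), (gridFlux s g i - gridFlux s g (i + 1)) * f i := by
  rw [sum_gridFlux_sub_mul, sum_gridFlux_sub_mul, hs]
  simp only [zero_mul]
  congr 1
  exact sum_congr rfl fun i _ => by ring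

namespace DualQHahnParams

variable {q A g : ℝ}

theorem gridFlux_gridBasis_succ_left (h : DualQHahnParams q A g) (M k i : ℕ) :
    gridFlux (dualQHahnConductance q A g (q ^ M)) (gridBasis q A (k + 1)) i =
      dualQHahnWeight q A g (q ^ M) i * (q ^ i / q ^ M * (1 - A * q ^ M * q ^ i)
        * (g - A * q ^ i / q) * (1 - q ^ k / q ^ i) * (1 - q ^ (k + 1))
          / (1 - A * (q ^ i) ^ 2)) * gridBasis q A k i := by
  cases i with
  | zero =>
    cases k with
    | zero => simp [gridFlux]
    | succ k => simp [gridFlux, gridBasis, qpoch_succ']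
  | succ i =>
    have hb := qpoch_mul_qpoch_backward_difference h.q_pos.ne' (h.pow_pos i).ne' A k
    simp only [gridFlux]
    rw [h.conductance_eq]
    simp only [gridBasis, pow_succ' q i]
    set Δ := qpoch q (q * q ^ i)⁻¹ (k + 1) * qpoch q (A * (q * q ^ i)) (k + 1)
      - qpoch q (q ^ i)⁻¹ (k + 1) * qpoch q (A * q ^ i) (k + 1)
    set P := qpoch q (q * q ^ i)⁻¹ k * qpoch q (A * (q * q ^ i)) k
    have h1 : 1 - q * q ^ i = -(q * q ^ i) * (1 - (q * q ^ i)⁻¹) := by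
      have := (h.pow_pos i).ne'
      have := h.q_pos.ne'
      field_simp
      ring
    have h2 := (h.one_sub_A_mul_q_mul_sq_pos i).ne'
    have h3 : 1 - A * (q * q ^ i) ^ 2 ≠ 0 := by
      have := (h.one_sub_A_mul_sq_pos (i + 1)).ne'
      rwa [pow_succ' q i] at this
    have h4 := (h.pow_pos i).ne'
    have h5 := h.q_pos.ne'
    have h6 := (h.pow_pos M).ne'
    rw [h1]
    generalize dualQHahnWeight q A g (q ^ M) (i + 1) = w
    generalize q ^ M = K at *
    generalize q ^ i = u at *
    generalize q ^ k = z at *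
    calc w * (q * u / K * (-(q * u) * (1 - (q * u)⁻¹)) * (1 - A * K * (q * u)) * (g - A * u)
          / ((1 - A * q * u ^ 2) * (1 - A * (q * u) ^ 2))) * Δ
        = w * (q * u / K * (-(q * u)) * (1 - A * K * (q * u)) * (g - A * u)
          / ((1 - A * q * u ^ 2) * (1 - A * (q * u) ^ 2))) * ((1 - (q * u)⁻¹) * Δ) := by ring
      _ = _ := by
        rw [hb]
        generalize 1 - A * (q * u) ^ 2 = d at *
        generalize 1 - A * q * u ^ 2 = e at *
        field_simp
        ring

theorem gridFlux_gridBasis_succ_right (h : DualQHahnParams q A g) (M k i : ℕ) :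
    gridFlux (dualQHahnConductance q A g (q ^ M)) (gridBasis q A (k + 1)) (i + 1) =
      dualQHahnWeight q A g (q ^ M) i * ((1 - q ^ i / q ^ M) * (1 - g * q * q ^ i)
        * (1 - A * q ^ i * q ^ k) / (q * q ^ i) * (1 - q ^ (k + 1)) / (1 - A * (q ^ i) ^ 2))
        * gridBasis q A k i := by
  have hf := qpoch_mul_qpoch_forward_difference h.q_pos.ne' (h.pow_pos i).ne' A k
  simp only [gridFlux, dualQHahnConductance, gridBasis, pow_succ' q i]
  set Δ := qpoch q (q * q ^ i)⁻¹ (k + 1) * qpoch q (A * (q * q ^ i)) (k + 1)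
    - qpoch q (q ^ i)⁻¹ (k + 1) * qpoch q (A * q ^ i) (k + 1)
  set P := qpoch q (q ^ i)⁻¹ k * qpoch q (A * q ^ i) k
  have h2 := (h.one_sub_A_mul_q_mul_sq_pos i).ne'
  have h3 := (h.one_sub_A_mul_sq_pos i).ne'
  have h4 := (h.pow_pos i).ne'
  have h5 := h.q_pos.ne'
  have h6 := (h.pow_pos M).ne'
  generalize dualQHahnWeight q A g (q ^ M) i = w
  generalize q ^ M = K at *
  generalize q ^ i = u at *
  generalize q ^ k = z at *
  calc w * ((u - K) * (1 - g * q * u) * (1 - A * u)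
        / (K * (1 - A * u ^ 2) * (1 - A * q * u ^ 2))) * Δ
      = w * ((u - K) * (1 - g * q * u)
        / (K * (1 - A * u ^ 2) * (1 - A * q * u ^ 2))) * ((1 - A * u) * Δ) := by ring
    _ = _ := by
      rw [hf]
      generalize 1 - A * u ^ 2 = d at *
      generalize 1 - A * q * u ^ 2 = e at *
      field_simp
      ring

/-- The difference operator acts on the basis as a lower bidiagonal matrix. -/
theorem gridFlux_gridBasis_sub (h : DualQHahnParams q A g) (M k i : ℕ) :
    gridFlux (dualQHahnConductance q A g (q ^ M)) (gridBasis q A (k + 1)) i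
      - gridFlux (dualQHahnConductance q A g (q ^ M)) (gridBasis q A (k + 1)) (i + 1) =
    dualQHahnWeight q A g (q ^ M) i * (((q ^ (k + 1))⁻¹ - 1) * gridBasis q A (k + 1) i
      - (1 - q ^ (k + 1)) * (1 - q ^ k / q ^ M) * (1 - g * q * q ^ k) / (q * q ^ k)
        * gridBasis q A k i) := by
  have hi := dualQHahn_rational_identity (g := g) h.q_pos.ne' (h.pow_pos M).ne' (h.pow_pos i).ne'
    (h.pow_pos k).ne' A
  have hs : gridBasis q A (k + 1) i =
      (1 - q ^ k / q ^ i) * (1 - A * q ^ i * q ^ k) * gridBasis q A k i := by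
    simp only [gridBasis, qpoch_succ]
    ring
  have hl : (q ^ (k + 1))⁻¹ - 1 = (1 - q ^ (k + 1)) / (q * q ^ k) := by
    have := (h.pow_pos k).ne'
    have := h.q_pos.ne'
    rw [pow_succ']
    field_simp
  rw [h.gridFlux_gridBasis_succ_left, h.gridFlux_gridBasis_succ_right, hs, hl]
  have h3 := (h.one_sub_A_mul_sq_pos i).ne'
  generalize dualQHahnWeight q A g (q ^ M) i = w
  generalize gridBasis q A k i = P
  generalize 1 - q ^ (k + 1) = e
  generalize q ^ M = K at *
  generalize q ^ i = u at *
  generalize q ^ k = z at *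
  calc _ = w * P * e / (1 - A * u ^ 2) * (-((1 - u / K) * (1 - g * q * u) * (1 - A * u * z)
        / (q * u)) + u / K * (1 - A * K * u) * (g - A * u / q) * (1 - z / u)) := by ring
    _ = w * P * e * ((1 - A * u ^ 2) / (1 - A * u ^ 2))
        * ((1 - z / u) * (1 - A * u * z) / (q * z)
          - (1 - z / K) * (1 - g * q * z) / (q * z)) := by rw [hi]; ring
    _ = _ := by rw [div_self h3]; ring

theorem one_sub_pow_div_ne_zero (h : DualQHahnParams q A g) {k n : ℕ} (hkn : k < n) :
    1 - q ^ k / q ^ n ≠ 0 := by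
  have := (one_lt_div (h.pow_pos n)).2 (pow_lt_pow_right_of_lt_one₀ h.q_pos h.q_lt_one hkn)
  linarith

theorem qpoch_ne_zero_of_le (h : DualQHahnParams q A g) {k n : ℕ} (hkn : k ≤ n) :
    qpoch q (q ^ n)⁻¹ k ≠ 0 := by
  refine prod_ne_zero_iff.2 fun j hj => ?_
  rw [inv_mul_eq_div]
  exact h.one_sub_pow_div_ne_zero ((mem_range.1 hj).trans_le hkn)

theorem qpoch_g_ne_zero (h : DualQHahnParams q A g) (k : ℕ) : qpoch q (g * q) k ≠ 0 :=
  prod_ne_zero_iff.2 fun j _ => (h.one_sub_g_mul_pos j).ne'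

theorem qpoch_q_ne_zero (h : DualQHahnParams q A g) (k : ℕ) : qpoch q q k ≠ 0 :=
  prod_ne_zero_iff.2 fun j _ => (h.one_sub_q_mul_pos j).ne'

theorem dualQHahnCoeff_ne_zero (h : DualQHahnParams q A g) {M n k : ℕ} (hn : n ≤ M)
    (hk : k ≤ n) : dualQHahnCoeff q g (q ^ M) n k ≠ 0 :=
  div_ne_zero (mul_ne_zero (h.qpoch_ne_zero_of_le hk) (h.pow_pos k).ne')
    (mul_ne_zero (mul_ne_zero (h.qpoch_g_ne_zero k) (h.qpoch_ne_zero_of_le (hk.trans hn)))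
      (h.qpoch_q_ne_zero k))

theorem dualQHahnCoeff_succ (h : DualQHahnParams q A g) {M n k : ℕ} (hk : k < M) :
    dualQHahnCoeff q g (q ^ M) n (k + 1) *
      (-((1 - q ^ (k + 1)) * (1 - q ^ k / q ^ M) * (1 - g * q * q ^ k) / (q * q ^ k))) =
    ((q ^ n)⁻¹ - (q ^ k)⁻¹) * dualQHahnCoeff q g (q ^ M) n k := by
  have h1 := h.qpoch_g_ne_zero k
  have h2 := h.qpoch_ne_zero_of_le hk.le
  have h3 := h.qpoch_q_ne_zero k
  have h4 := h.one_sub_pow_div_ne_zero hk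
  have h5 := (h.one_sub_g_mul_pos k).ne'
  have h6 := (h.one_sub_q_mul_pos k).ne'
  have h7 := (h.pow_pos k).ne'
  have h8 := h.q_pos.ne'
  have h9 := (h.pow_pos n).ne'
  simp only [dualQHahnCoeff, qpoch_succ, inv_mul_eq_div, pow_succ' q k]
  generalize qpoch q (g * q) k = a1 at *
  generalize qpoch q (q ^ M)⁻¹ k = a2 at *
  generalize qpoch q q k = a3 at *
  generalize 1 - q ^ k / q ^ M = a4 at *
  generalize 1 - g * q * q ^ k = a5 at *
  generalize 1 - q * q ^ k = a6 at *
  field_simp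
  ring

/-- The dual `q`-Hahn polynomials are eigenfunctions of the difference operator. -/
theorem gridFlux_dualQHahnValue_sub (h : DualQHahnParams q A g) {M n : ℕ} (hn : n ≤ M) (i : ℕ) :
    gridFlux (dualQHahnConductance q A g (q ^ M)) (dualQHahnValue q A g (q ^ M) n) i
      - gridFlux (dualQHahnConductance q A g (q ^ M)) (dualQHahnValue q A g (q ^ M) n) (i + 1) =
    ((q ^ n)⁻¹ - 1) * (dualQHahnWeight q A g (q ^ M) i * dualQHahnValue q A g (q ^ M) n i) := by
  have hzero : ∀ i, gridFlux (dualQHahnConductance q A g (q ^ M)) (gridBasis q A 0) i = 0 := by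
    intro i
    cases i <;> simp [gridFlux, gridBasis, qpoch_zero]
  have hval : dualQHahnValue q A g (q ^ M) n = fun i => ∑ k ∈ range (n + 1),
    dualQHahnCoeff q g (q ^ M) n k * gridBasis q A k i := rfl
  rw [hval, gridFlux_sum, gridFlux_sum, ← sum_sub_distrib, sum_range_succ', hzero, hzero]
  simp only [mul_zero, sub_self, add_zero, ← mul_sub, h.gridFlux_gridBasis_sub]
  have hrec : ∀ k ∈ range n, dualQHahnCoeff q g (q ^ M) n (k + 1) *
      (dualQHahnWeight q A g (q ^ M) i * (((q ^ (k + 1))⁻¹ - 1) * gridBasis q A (k + 1) i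
      - (1 - q ^ (k + 1)) * (1 - q ^ k / q ^ M) * (1 - g * q * q ^ k) / (q * q ^ k)
        * gridBasis q A k i)) =
      dualQHahnWeight q A g (q ^ M) i * (((q ^ (k + 1))⁻¹ - 1) *
        (dualQHahnCoeff q g (q ^ M) n (k + 1) * gridBasis q A (k + 1) i)) +
      dualQHahnWeight q A g (q ^ M) i * (((q ^ n)⁻¹ - (q ^ k)⁻¹) *
        (dualQHahnCoeff q g (q ^ M) n k * gridBasis q A k i)) := by
    intro k hk
    linear_combination dualQHahnWeight q A g (q ^ M) i * gridBasis q A k i *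
      h.dualQHahnCoeff_succ (n := n) ((mem_range.1 hk).trans_le hn)
  rw [sum_congr rfl hrec, sum_add_distrib]
  have hl : ∑ k ∈ range n, dualQHahnWeight q A g (q ^ M) i * (((q ^ (k + 1))⁻¹ - 1) *
        (dualQHahnCoeff q g (q ^ M) n (k + 1) * gridBasis q A (k + 1) i)) =
      ∑ k ∈ range (n + 1), dualQHahnWeight q A g (q ^ M) i * (((q ^ k)⁻¹ - 1) *
        (dualQHahnCoeff q g (q ^ M) n k * gridBasis q A k i)) := by
    rw [sum_range_succ' _ n]
    simp
  have hr : ∑ k ∈ range n, dualQHahnWeight q A g (q ^ M) i * (((q ^ n)⁻¹ - (q ^ k)⁻¹) *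
        (dualQHahnCoeff q g (q ^ M) n k * gridBasis q A k i)) =
      ∑ k ∈ range (n + 1), dualQHahnWeight q A g (q ^ M) i * (((q ^ n)⁻¹ - (q ^ k)⁻¹) *
        (dualQHahnCoeff q g (q ^ M) n k * gridBasis q A k i)) := by
    rw [sum_range_succ _ n]
    simp
  rw [hl, hr, ← sum_add_distrib, mul_sum, mul_sum]
  exact sum_congr rfl fun k _ => by ring

/-- Orthogonality of the dual `q`-Hahn polynomials against the basis. -/
theorem sum_dualQHahnValue_mul_gridBasis (h : DualQHahnParams q A g) {M n : ℕ} (hn : n ≤ M)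
    (m : ℕ) (hm : m < n) : ∑ i ∈ range (M + 1), dualQHahnWeight q A g (q ^ M) i *
      (dualQHahnValue q A g (q ^ M) n i * gridBasis q A m i) = 0 := by
  have hs : dualQHahnConductance q A g (q ^ M) M = 0 := by simp [dualQHahnConductance]
  have hsym := fun f => sum_gridFlux_sub_mul_comm _ (dualQHahnValue q A g (q ^ M) n) f hs
  simp only [h.gridFlux_dualQHahnValue_sub hn] at hsym
  have hne : ∀ k < n, (q ^ n)⁻¹ - (q ^ k)⁻¹ ≠ 0 := fun k hk => by
    have := inv_strictAnti₀ (h.pow_pos n) (pow_lt_pow_right_of_lt_one₀ h.q_pos h.q_lt_one hk)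
    linarith
  induction m with
  | zero =>
    refine (mul_eq_zero.1 ?_).resolve_left (hne 0 hm)
    have := hsym (gridBasis q A 0)
    have hzero : ∀ i, gridFlux (dualQHahnConductance q A g (q ^ M)) (gridBasis q A 0) i = 0 := by
      intro i
      cases i <;> simp [gridFlux, gridBasis, qpoch_zero]
    simp only [hzero, sub_self, zero_mul, sum_const_zero] at this
    rw [← this, mul_sum]
    exact sum_congr rfl fun i _ => by simp only [pow_zero, inv_one]; ring
  | succ m ih =>
    refine (mul_eq_zero.1 ?_).resolve_left (hne (m + 1) hm)
    have hE := hsym (gridBasis q A (m + 1))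
    have h0 := ih (by omega)
    simp only [h.gridFlux_gridBasis_sub] at hE
    rw [← sub_eq_zero, ← sum_sub_distrib] at hE
    rw [mul_sum, ← hE, ← sub_eq_zero, ← sum_sub_distrib]
    calc _ = (-((1 - q ^ (m + 1)) * (1 - q ^ m / q ^ M) * (1 - g * q * q ^ m) / (q * q ^ m))) *
          ∑ i ∈ range (M + 1), dualQHahnWeight q A g (q ^ M) i *
      (dualQHahnValue q A g (q ^ M) n i * gridBasis q A m i) := by
          rw [mul_sum]
          exact sum_congr rfl fun i _ => by ring
      _ = 0 := by rw [h0, mul_zero]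

end DualQHahnParams

/-- A linear condition on polynomials of degree below `n` can be checked on a family with one
polynomial of each degree. -/
theorem sum_eval_mul_eq_zero_of_basis {I : Finset ℕ} {x v : ℕ → ℝ} {φ : ℕ → ℝ[X]}
    (hφ : ∀ k, (φ k).degree = k) (m : ℕ)
    (h : ∀ k < m, ∑ i ∈ I, v i * (φ k).eval (x i) = 0) (f : ℝ[X]) (hf : f.degree < m) :
    ∑ i ∈ I, v i * f.eval (x i) = 0 := by
  induction m generalizing f with
  | zero =>
    have : f = 0 := by simpa using hf
    simp [this]
  | succ m ih =>
    have hφ0 : φ m ≠ 0 := fun h0 => by simpa [h0] using hφ m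
    have hlead : (φ m).coeff m ≠ 0 := by
      have := leadingCoeff_ne_zero.2 hφ0
      rwa [leadingCoeff, natDegree_eq_of_degree_eq_some (hφ m)] at this
    set c := f.coeff m / (φ m).coeff m with hc
    have hlt : (f - C c * φ m).degree < m := by
      rw [degree_lt_iff_coeff_zero] at hf ⊢
      intro j hj
      rcases hj.eq_or_lt with rfl | hj
      · simp [hc, hlead]
      · rw [coeff_sub, coeff_C_mul, hf j hj, coeff_eq_zero_of_degree_lt (n := j)]
        · simp
        · rw [hφ]
          exact_mod_cast hj
    have h0 := ih (fun k hk => h k (by omega)) _ hlt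
    have h1 := h m (Nat.lt_succ_self m)
    have : ∑ i ∈ I, v i * f.eval (x i) = ∑ i ∈ I, v i * (f - C c * φ m).eval (x i)
        + c * ∑ i ∈ I, v i * (φ m).eval (x i) := by
      rw [mul_sum, ← sum_add_distrib]
      refine sum_congr rfl fun i _ => ?_
      simp only [eval_sub, eval_mul, eval_C]
      ring
    rw [this, h0, h1, mul_zero, add_zero]

/-- The dual `q`-Hahn polynomial as a formal polynomial, with `b = q ^ a`. -/
noncomputable def dualQHahnFormal (q b g K : ℝ) (n : ℕ) : ℝ[X] :=
  ∑ k ∈ range (n + 1), C (dualQHahnCoeff q g K n k) * qQuadraticBasis q b k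

theorem eval_dualQHahnFormal_grid {q b : ℝ} (hq : q ≠ 0) (hb : b ≠ 0) (g K : ℝ) (n i : ℕ) :
    (dualQHahnFormal q b g K n).eval (qQuadraticGrid q b i) =
      dualQHahnValue q (b ^ 2) g K n i := by
  simp only [dualQHahnFormal, dualQHahnValue, eval_finsetSum, eval_mul, eval_C,
    eval_qQuadraticBasis_grid hq hb, gridBasis]

theorem dualQHahnPoly_eq_eval {q : ℝ} (hq : 0 < q) (a α : ℝ) {N : ℕ} (hN : 1 ≤ N) (n : ℕ) (y : ℝ) :
    dualQHahnPoly q a N n α y =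
      (dualQHahnFormal q (q ^ a) (q ^ α) (q ^ (N - 1)) n).eval y := by
  have hK : q ^ ((1 : ℝ) - (N : ℝ)) = (q ^ (N - 1))⁻¹ := by
    rw [← Real.rpow_natCast, ← Real.rpow_neg hq.le, Nat.cast_sub hN]
    congr 1
    push_cast
    ring
  have hprod : ∀ j : ℕ, q ^ (a + (j : ℝ)) = q ^ a * q ^ j := fun j => by
    rw [Real.rpow_add hq, Real.rpow_natCast]
  have hsq : ∀ j : ℕ, q ^ (2 * (a + (j : ℝ))) = (q ^ a * q ^ j) ^ 2 := fun j => by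
    rw [← hprod, ← Real.rpow_natCast (q ^ (a + (j : ℝ))), ← Real.rpow_mul hq.le]
    congr 1
    push_cast
    ring
  have hg : q ^ (α + 1) = q ^ α * q := by rw [Real.rpow_add hq, Real.rpow_one]
  simp only [dualQHahnPoly, dualQHahnFormal, dualQHahnCoeff, eval_finsetSum, eval_mul, eval_C,
    eval_qQuadraticBasis, hK, hprod, hsq, hg, zpow_neg, zpow_natCast]
  exact sum_congr rfl fun k _ => by ring

theorem DualQHahnParams.of_rpow {q a α : ℝ} (hq0 : 0 < q) (hq1 : q < 1) (ha : 0 < a)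
    (hα : -1 < α) (hα' : α < 2 * a) : DualQHahnParams q ((q ^ a) ^ 2) (q ^ α) where
  q_pos := hq0
  q_lt_one := hq1
  A_pos := by positivity
  A_lt_one := pow_lt_one₀ (by positivity) (Real.rpow_lt_one hq0.le hq1 ha) two_ne_zero
  A_lt_g := by
    rw [← Real.rpow_natCast (q ^ a), ← Real.rpow_mul hq0.le]
    refine Real.rpow_lt_rpow_of_exponent_gt hq0 hq1 ?_
    push_cast
    linarith
  g_mul_q_lt_one := by
    have : q ^ α * q = q ^ (α + 1) := by rw [Real.rpow_add hq0, Real.rpow_one]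
    rw [this]
    exact Real.rpow_lt_one hq0.le hq1 (by linarith)

namespace DualQHahnParams

variable {q b g : ℝ}

theorem degree_dualQHahnFormal (h : DualQHahnParams q (b ^ 2) g) (hb : b ≠ 0) {M n : ℕ}
    (hn : n ≤ M) : (dualQHahnFormal q b g (q ^ M) n).degree = n := by
  have hc := h.dualQHahnCoeff_ne_zero hn le_rfl
  have hlast : (C (dualQHahnCoeff q g (q ^ M) n n) * qQuadraticBasis q b n).degree = n := by
    rw [degree_C_mul hc, degree_qQuadraticBasis h.q_pos.ne' hb]
  rw [dualQHahnFormal, sum_range_succ, degree_add_eq_right_of_degree_lt, hlast]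
  rw [hlast]
  refine (degree_sum_le _ _).trans_lt ((Finset.sup_lt_iff (WithBot.bot_lt_coe _)).2 fun k hk => ?_)
  rw [← smul_eq_C_mul]
  refine (degree_smul_le _ _).trans_lt ?_
  rw [degree_qQuadraticBasis h.q_pos.ne' hb]
  exact_mod_cast mem_range.1 hk

theorem sum_dualQHahnFormal_mul (h : DualQHahnParams q (b ^ 2) g) (hb : b ≠ 0) {M n : ℕ}
    (hn : n ≤ M) (f : ℝ[X]) (hf : f.degree < n) :
    ∑ i ∈ range (M + 1), dualQHahnWeight q (b ^ 2) g (q ^ M) i *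
      (dualQHahnFormal q b g (q ^ M) n * f).eval (qQuadraticGrid q b i) = 0 := by
  simp only [eval_mul, eval_dualQHahnFormal_grid h.q_pos.ne' hb, ← mul_assoc]
  refine sum_eval_mul_eq_zero_of_basis (degree_qQuadraticBasis h.q_pos.ne' hb) n
    (fun k hk => ?_) f hf
  rw [← h.sum_dualQHahnValue_mul_gridBasis hn k hk]
  exact sum_congr rfl fun i _ => by
    rw [eval_qQuadraticBasis_grid h.q_pos.ne' hb, gridBasis]; ring

/-- The zeros of the dual `q`-Hahn polynomial are real and simple. -/
theorem exists_zeros (h : DualQHahnParams q (b ^ 2) g) (hb0 : 0 < b) (hb1 : b < 1) {M n : ℕ}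
    (hn : n ≤ M) : ∃ S : Finset ℝ, S.card = n ∧
      (∀ y, (dualQHahnFormal q b g (q ^ M) n).eval y = 0 ↔ y ∈ S) ∧
      ∀ f : ℝ[X], f.degree < n → ∑ i ∈ range (M + 1), dualQHahnWeight q (b ^ 2) g (q ^ M) i *
        ((∏ s ∈ S, (X - C s)) * f).eval (qQuadraticGrid q b i) = 0 := by
  have hdeg := h.degree_dualQHahnFormal hb0.ne' hn
  have hne : dualQHahnFormal q b g (q ^ M) n ≠ 0 := fun h0 => by simp [h0] at hdeg
  obtain ⟨S, hS, heq⟩ := exists_eq_C_mul_prod_of_orthogonal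
    (qQuadraticGrid_strictMono h.q_pos h.q_lt_one hb0 hb1)
    (fun i hi => h.weight_pos (Nat.lt_succ_iff.1 hi)) hne
    (natDegree_eq_of_degree_eq_some hdeg) (Nat.lt_succ_iff.2 hn)
    (h.sum_dualQHahnFormal_mul hb0.ne' hn)
  have hl := leadingCoeff_ne_zero.2 hne
  refine ⟨S, hS, fun y => ?_, fun f hf => ?_⟩
  · rw [heq, eval_mul, eval_C, mul_eq_zero, or_iff_right hl, eval_prod, prod_eq_zero_iff]
    simp [sub_eq_zero]
  · have h0 := h.sum_dualQHahnFormal_mul hb0.ne' hn f hf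
    rw [heq] at h0
    refine (mul_eq_zero.1 (Eq.trans ?_ h0)).resolve_left hl
    rw [mul_sum]
    refine sum_congr rfl fun i _ => ?_
    simp only [eval_mul, eval_C]
    ring

end DualQHahnParams

/-- zeros of dual q-Hahn polynomials: monotonicity in `α`. -/
theorem stmt_19 (q : ℝ) (hq0 : 0 < q) (hq1 : q < 1) (a : ℝ) (ha : 0 < a)
    (N n : ℕ) (hN : 2 ≤ N) (hn : 1 ≤ n) (hnN : n ≤ N - 1) :
    ∃ X : ℝ → Fin n → ℝ,
      (∀ α : ℝ, -1 < α → α < 2 * a →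
        StrictMono (X α) ∧
        (∀ j, dualQHahnPoly q a N n α (X α j) = 0) ∧
        (∀ y : ℝ, dualQHahnPoly q a N n α y = 0 → ∃ j, y = X α j)) ∧
      (1 / 2 ≤ a → ∀ j, StrictMonoOn (fun α => X α j) (Set.Ioo (-1) (2 * a))) ∧
      (a < 1 / 2 → ∀ j, StrictMonoOn (fun α => X α j) (Set.Ioo (a - 1 / 2) (2 * a))) := by
  have hb0 : 0 < q ^ a := Real.rpow_pos_of_pos hq0 a
  have hb1 : q ^ a < 1 := Real.rpow_lt_one hq0.le hq1 ha
  have hparams : ∀ α : ℝ, -1 < α ∧ α < 2 * a → DualQHahnParams q ((q ^ a) ^ 2) (q ^ α) :=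
    fun α hα => .of_rpow hq0 hq1 ha hα.1 hα.2
  choose! S hcard hzero horth using fun α hα => (hparams α hα).exists_zeros hb0 hb1 hnN
  have hpoly := fun α => dualQHahnPoly_eq_eval hq0 a α (N := N) (by omega) n
  classical
  have hX : ∀ α, ∃ Y : Fin n → ℝ, ∀ hα : -1 < α ∧ α < 2 * a,
      Y = (S α).orderEmbOfFin (hcard α hα) := fun α => by
    by_cases hα : -1 < α ∧ α < 2 * a
    · exact ⟨(S α).orderEmbOfFin (hcard α hα), fun _ => rfl⟩
    · exact ⟨0, fun h => absurd h hα⟩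
  choose Y hY using hX
  have hmono : ∀ j, StrictMonoOn (fun α => Y α j) (Set.Ioo (-1) (2 * a)) := by
    intro j α hα β hβ hlt
    simp only [hY α hα, hY β hβ]
    have hg : q ^ β < q ^ α := Real.rpow_lt_rpow_of_exponent_gt hq0 hq1 hlt
    have hA := hparams α hα
    have hB := hparams β hβ
    set w := dualQHahnWeight q ((q ^ a) ^ 2) (q ^ α) (q ^ (N - 1)) with hw
    set W := dualQHahnWeight q ((q ^ a) ^ 2) (q ^ β) (q ^ (N - 1)) with hW
    have hwpos : ∀ i < N - 1 + 1, 0 < w i := fun i hi => hA.weight_pos (Nat.lt_succ_iff.1 hi)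
    have hWpos : ∀ i < N - 1 + 1, 0 < W i := fun i hi => hB.weight_pos (Nat.lt_succ_iff.1 hi)
    have hstep : ∀ i, i + 1 < N - 1 + 1 → W i / w i < W (i + 1) / w (i + 1) := by
      intro i hi
      have h1 : w (i + 1) = w i * _ := prod_range_succ _ _
      have h2 : W (i + 1) = W i * _ := prod_range_succ _ _
      rw [h1, h2, mul_div_mul_comm]
      refine lt_mul_of_one_lt_right (div_pos (hWpos i (by omega)) (hwpos i (by omega))) ?_
      exact (one_lt_div (hA.weightRatio_pos (by omega))).2
        (hA.weightRatio_lt hB hg (by omega))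
    refine orderEmbOfFin_lt_of_strictMono_ratio (N := N - 1 + 1) (ρ := fun i => W i / w i)
      (Nat.lt_succ_iff.2 hnN) (qQuadraticGrid_strictMono hq0 hq1 hb0 hb1) hwpos
      (fun i hi => (div_mul_cancel₀ _ (hwpos i hi).ne').symm)
      (fun i hi => div_pos (hWpos i hi) (hwpos i hi)) ?_ _ _ (horth α hα) (horth β hβ) j
    intro i k hik hk
    induction k, hik using Nat.le_induction with
    | base => exact hstep i hk
    | succ k hik ih => exact (ih (by omega)).trans (hstep k hk)
  refine ⟨Y, fun α h1 h2 => ?_, fun _ => hmono, fun _ j => (hmono j).mono ?_⟩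
  · have hα : -1 < α ∧ α < 2 * a := ⟨h1, h2⟩
    rw [hY α hα]
    refine ⟨OrderEmbedding.strictMono _, fun j => ?_, fun y hy => ?_⟩
    · rw [hpoly, hzero α hα]
      exact orderEmbOfFin_mem _ _ _
    · rw [hpoly, hzero α hα] at hy
      have : y ∈ Set.range ((S α).orderEmbOfFin (hcard α hα)) := by
        rw [range_orderEmbOfFin]; exact hy
      obtain ⟨j, hj⟩ := this
      exact ⟨j, hj.symm⟩
  · exact Set.Ioo_subset_Ioo_left (by linarith)
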